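/- arXiv:2212.01883 — 5 statements merged into one kernel-verified Lean document; each statement's English description precedes it below -/
import Mathlib

section
/- Define γ(δ) := ∏_{k=0}^∞ (1 + 2/δ^(2^k))² for real δ ≥ 2. Then the function δ ↦ δ²·γ(δ) is strictly increasing on [3,∞): for all real numbers 3 ≤ δ₁ < δ₂, δ₁²·γ(δ₁) < δ₂²·γ(δ₂). -/
/-- The products `∏ₖ (1 + 2x^(2^k))` converge for `0 ≤ x < 1`. -/
theorem multipliable_one_add_two_mul_pow_two_pow {x : ℝ} (h0 : 0 ≤ x) (h1 : x < 1) :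
    Multipliable fun k : ℕ => 1 + 2 * x ^ (2 ^ k) := by
  refine Real.multipliable_one_add_of_summable (Summable.mul_left 2 ?_)
  refine (summable_geometric_of_lt_one h0 h1).of_nonneg_of_le (fun k => by positivity) fun k => ?_
  exact pow_le_pow_of_le_one h0 h1.le Nat.lt_two_pow_self.le

theorem prod_range_succ_one_add_two_mul_pow_two_pow (x : ℝ) (n : ℕ) :
    ∏ k ∈ Finset.range (n + 1), (1 + 2 * x ^ (2 ^ k)) =
      (∏ k ∈ Finset.range n, (1 + 2 * (x ^ 2) ^ (2 ^ k))) * (1 + 2 * x) := by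
  rw [Finset.prod_range_succ']
  simp only [pow_zero, pow_one, ← pow_mul, pow_succ' 2]

/-- `(1 - 2x) ∏_{k < n} (1 + 2x^(2^k))` is antitone on `[0, 1/4]`. -/
theorem antitone_one_sub_two_mul_prod (n : ℕ) {x y : ℝ} (hx : 0 ≤ x) (hxy : x ≤ y)
    (hy : y ≤ 1 / 4) :
    (1 - 2 * y) * ∏ k ∈ Finset.range n, (1 + 2 * y ^ (2 ^ k)) ≤
      (1 - 2 * x) * ∏ k ∈ Finset.range n, (1 + 2 * x ^ (2 ^ k)) := by
  induction n generalizing x y with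
  | zero =>
    simp only [Finset.range_zero, Finset.prod_empty]
    linarith
  | succ n ih =>
    have hsq : x ^ 2 ≤ y ^ 2 := by gcongr
    have hy2 : y ^ 2 ≤ 1 / 4 := by nlinarith
    have hpos : ∀ {z : ℝ}, z ^ 2 ≤ 1 / 4 → 0 < 1 - 2 * z ^ 2 := fun h => by linarith
    have hfac : ∀ {z : ℝ}, z ^ 2 ≤ 1 / 4 →
        (1 - 2 * z) * ∏ k ∈ Finset.range (n + 1), (1 + 2 * z ^ (2 ^ k)) =
          (1 - 4 * z ^ 2) / (1 - 2 * z ^ 2) *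
            ((1 - 2 * z ^ 2) * ∏ k ∈ Finset.range n, (1 + 2 * (z ^ 2) ^ (2 ^ k))) := by
      intro z hz
      have := (hpos hz).ne'
      rw [prod_range_succ_one_add_two_mul_pow_two_pow, ← mul_assoc _ (1 - 2 * z ^ 2),
        div_mul_cancel₀ _ this]
      ring
    have hx2 := hsq.trans hy2
    rw [hfac hy2, hfac hx2]
    refine mul_le_mul ?_ (ih (sq_nonneg x) hsq hy2) ?_ ?_
    · rw [div_le_div_iff₀ (hpos hy2) (hpos hx2)]
      nlinarith
    · exact mul_nonneg (hpos hy2).le (Finset.prod_nonneg fun k _ => by positivity)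
    · exact div_nonneg (by linarith) (hpos hx2).le

theorem antitone_one_sub_two_mul_tprod {x y : ℝ} (hx : 0 ≤ x) (hxy : x ≤ y) (hy : y ≤ 1 / 4) :
    (1 - 2 * y) * ∏' k : ℕ, (1 + 2 * y ^ (2 ^ k)) ≤
      (1 - 2 * x) * ∏' k : ℕ, (1 + 2 * x ^ (2 ^ k)) := by
  have hlim : ∀ {z : ℝ}, 0 ≤ z → z ≤ 1 / 4 → Filter.Tendsto
      (fun n : ℕ => (1 - 2 * z) * ∏ k ∈ Finset.range n, (1 + 2 * z ^ (2 ^ k))) Filter.atTop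
      (nhds ((1 - 2 * z) * ∏' k : ℕ, (1 + 2 * z ^ (2 ^ k)))) := fun h0 h1 =>
    (multipliable_one_add_two_mul_pow_two_pow h0 (by linarith)).hasProd.tendsto_prod_nat.const_mul _
  exact le_of_tendsto_of_tendsto' (hlim (hx.trans hxy) hy) (hlim hx (hxy.trans hy))
    fun n => antitone_one_sub_two_mul_prod n hx hxy hy

theorem one_le_tprod_one_add_two_mul_pow_two_pow {x : ℝ} (h0 : 0 ≤ x) (h1 : x < 1) :
    1 ≤ ∏' k : ℕ, (1 + 2 * x ^ (2 ^ k)) := by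
  refine ge_of_tendsto' (multipliable_one_add_two_mul_pow_two_pow h0 h1).hasProd.tendsto_prod_nat
    fun n => ?_
  exact Finset.one_le_prod fun k _ => by
    have : 0 ≤ x ^ (2 ^ k) := by positivity
    linarith

theorem sq_mul_tprod_sq_eq {d : ℝ} (hd : 3 ≤ d) :
    d ^ 2 * ∏' k : ℕ, (1 + 2 / d ^ (2 ^ k)) ^ 2 =
      ((d + 2 + 2 * (d + 2) / (d ^ 2 - 2)) *
        ((1 - 2 * (d⁻¹) ^ 2) * ∏' k : ℕ, (1 + 2 * ((d⁻¹) ^ 2) ^ (2 ^ k)))) ^ 2 := by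
  have h0 : 0 ≤ d⁻¹ := by positivity
  have h1 : d⁻¹ < 1 := inv_lt_one_of_one_lt₀ (by linarith)
  have hm := multipliable_one_add_two_mul_pow_two_pow h0 h1
  have hm2 := multipliable_one_add_two_mul_pow_two_pow (sq_nonneg d⁻¹)
    (pow_lt_one₀ h0 h1 two_ne_zero)
  have hsplit : ∏' k : ℕ, (1 + 2 * d⁻¹ ^ (2 ^ k)) =
      (1 + 2 * d⁻¹) * ∏' k : ℕ, (1 + 2 * (d⁻¹ ^ 2) ^ (2 ^ k)) := by
    refine tendsto_nhds_unique
      ((Filter.tendsto_add_atTop_iff_nat 1).2 hm.hasProd.tendsto_prod_nat) ?_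
    simp only [prod_range_succ_one_add_two_mul_pow_two_pow]
    rw [mul_comm (1 + 2 * d⁻¹)]
    exact hm2.hasProd.tendsto_prod_nat.mul_const _
  have hsq : ∏' k : ℕ, (1 + 2 / d ^ (2 ^ k)) ^ 2 = (∏' k : ℕ, (1 + 2 * d⁻¹ ^ (2 ^ k))) ^ 2 := by
    simp only [div_eq_mul_inv, ← inv_pow]
    rw [sq, ← hm.tprod_mul hm]
    exact tprod_congr fun k => sq _
  have hd0 : d ≠ 0 := by positivity
  have hd2 : d ^ 2 - 2 ≠ 0 := by nlinarith
  rw [hsq, hsplit, ← mul_pow, ← mul_assoc, ← mul_assoc]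
  congr 2
  field_simp
  ring

theorem add_two_add_div_lt {a b : ℝ} (ha : 3 ≤ a) (hab : a < b) :
    a + 2 + 2 * (a + 2) / (a ^ 2 - 2) < b + 2 + 2 * (b + 2) / (b ^ 2 - 2) := by
  have ha2 : 0 < a ^ 2 - 2 := by nlinarith
  have hb2 : 0 < b ^ 2 - 2 := by nlinarith
  have key : 0 < (a ^ 2 - 2) * (b ^ 2 - 2) - 2 * (a * b + 2 * a + 2 * b + 2) := by
    obtain ⟨s, rfl⟩ : ∃ s, a = 3 + s := ⟨a - 3, by ring⟩
    obtain ⟨t, rfl⟩ : ∃ t, b = 3 + t := ⟨b - 3, by ring⟩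
    have hs : 0 ≤ s := by linarith
    have ht : 0 ≤ t := by linarith
    ring_nf
    positivity
  have hdiff : b + 2 + 2 * (b + 2) / (b ^ 2 - 2) - (a + 2 + 2 * (a + 2) / (a ^ 2 - 2)) =
      (b - a) * ((a ^ 2 - 2) * (b ^ 2 - 2) - 2 * (a * b + 2 * a + 2 * b + 2)) /
        ((a ^ 2 - 2) * (b ^ 2 - 2)) := by
    field_simp
    ring
  rw [← sub_pos, hdiff]
  exact div_pos (mul_pos (sub_pos.2 hab) key) (mul_pos ha2 hb2)

/-- `δ ↦ δ²·γ(δ)` with `γ(δ) := ∏ₖ (1 + 2/δ^(2^k))²` is strictly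
increasing on `[3,∞)`. -/
theorem stmt_11 :
    StrictMonoOn (fun d : ℝ => d ^ 2 * ∏' k : ℕ, (1 + 2 / d ^ (2 ^ k)) ^ 2)
      (Set.Ici (3 : ℝ)) := by
  intro a ha b hb hab
  simp only [Set.mem_Ici] at ha hb
  have ha2 : 0 < a ^ 2 - 2 := by nlinarith
  have hinv : b⁻¹ ^ 2 ≤ a⁻¹ ^ 2 := by gcongr
  have hle : a⁻¹ ^ 2 ≤ 1 / 4 := by
    have : a⁻¹ ≤ 3⁻¹ := by gcongr
    have : 0 ≤ a⁻¹ := by positivity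
    nlinarith
  have hpos : 0 < (1 - 2 * a⁻¹ ^ 2) * ∏' k : ℕ, (1 + 2 * (a⁻¹ ^ 2) ^ (2 ^ k)) :=
    mul_pos (by linarith) (one_pos.trans_le
      (one_le_tprod_one_add_two_mul_pow_two_pow (sq_nonneg _) (by linarith)))
  have hfac : 0 < a + 2 + 2 * (a + 2) / (a ^ 2 - 2) := by positivity
  have hlt := add_two_add_div_lt ha hab
  simp only [sq_mul_tprod_sq_eq ha, sq_mul_tprod_sq_eq hb]
  refine pow_lt_pow_left₀ ?_ (mul_pos hfac hpos).le two_ne_zero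
  exact mul_lt_mul hlt (antitone_one_sub_two_mul_tprod (sq_nonneg _) hinv hle) hpos
    (hfac.trans hlt).le
end

section
/- Define γ : ℕ → ℝ by γ(1) := 25 and γ(δ) := ∏_{k=0}^∞ (1 + 2/δ^(2^k))² for integers δ ≥ 2. If δ₁, δ₂ ≥ 1 are integers with δ₁ ≤ (δ₂ + 2)², then δ₁·γ(δ₁) ≤ δ₂²·γ(δ₂). -/
/-- `γ(1) := 25` and `γ(δ) := ∏ₖ (1 + 2/δ^(2^k))²` for integers `δ ≥ 2`. -/
noncomputable def gam (d : ℕ) : ℝ :=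
  if d ≤ 1 then 25 else ∏' k : ℕ, (1 + 2 / (d : ℝ) ^ (2 ^ k)) ^ 2

open Filter Topology Finset

theorem summable_two_div_pow_two_pow {d : ℕ} (hd : 2 ≤ d) :
    Summable fun k : ℕ => 2 / (d : ℝ) ^ (2 ^ k) := by
  have hd' : (2 : ℝ) ≤ d := by exact_mod_cast hd
  have hs : Summable fun k : ℕ => 2 * ((d : ℝ)⁻¹) ^ k :=
    (summable_geometric_of_lt_one (by positivity)
      (inv_lt_one_of_one_lt₀ (by linarith))).mul_left 2
  refine hs.of_nonneg_of_le (fun k => by positivity) fun k => ?_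
  rw [inv_pow, ← div_eq_mul_inv]
  gcongr
  · linarith
  · exact Nat.lt_two_pow_self.le

theorem tendsto_prod_gam {d : ℕ} (hd : 2 ≤ d) :
    Tendsto (fun n => ∏ k ∈ range n, (1 + 2 / (d : ℝ) ^ (2 ^ k)) ^ 2) atTop (𝓝 (gam d)) := by
  have hm : Multipliable fun k : ℕ => 1 + 2 / (d : ℝ) ^ (2 ^ k) :=
    Real.multipliable_one_add_of_summable (summable_two_div_pow_two_pow hd)
  have hm2 : Multipliable fun k : ℕ => (1 + 2 / (d : ℝ) ^ (2 ^ k)) ^ 2 := by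
    simpa only [sq] using hm.mul hm
  rw [gam, if_neg (by lia)]
  exact hm2.hasProd.tendsto_prod_nat

theorem gam_anti {a b : ℕ} (ha : 2 ≤ a) (hab : a ≤ b) : gam b ≤ gam a := by
  refine le_of_tendsto_of_tendsto' (tendsto_prod_gam (ha.trans hab)) (tendsto_prod_gam ha)
    fun n => ?_
  have : (0 : ℝ) < a := by exact_mod_cast (by lia : 0 < a)
  gcongr

theorem one_le_gam {d : ℕ} (hd : 2 ≤ d) : 1 ≤ gam d := by
  refine ge_of_tendsto' (tendsto_prod_gam hd) fun n => ?_
  calc (1 : ℝ) = ∏ k ∈ range n, 1 := prod_const_one.symm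
    _ ≤ _ := prod_le_prod (fun _ _ => zero_le_one) fun k _ =>
      one_le_pow₀ (le_add_of_nonneg_right (by positivity))

theorem gam_eq_mul_gam_sq {d : ℕ} (hd : 2 ≤ d) :
    gam d = (1 + 2 / (d : ℝ)) ^ 2 * gam (d ^ 2) := by
  have h := (tendsto_prod_gam (hd.trans (Nat.le_self_pow two_ne_zero d))).const_mul
    ((1 + 2 / (d : ℝ)) ^ 2)
  refine tendsto_nhds_unique ((tendsto_add_atTop_iff_nat 1).2 (tendsto_prod_gam hd))
    (h.congr fun n => ?_)
  rw [prod_range_succ', mul_comm]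
  simp only [Nat.cast_pow, ← pow_mul, pow_succ' 2, pow_zero, pow_one]

theorem prod_one_add_pow_two_pow (t : ℝ) (n : ℕ) :
    (1 - t) * ∏ k ∈ range n, (1 + t ^ (2 ^ k)) = 1 - t ^ (2 ^ n) := by
  induction n with
  | zero => simp
  | succ n ih => rw [prod_range_succ, ← mul_assoc, ih, pow_succ 2 n, pow_mul]; ring

theorem gam_le {d : ℕ} (hd : 2 ≤ d) : gam d ≤ (1 / (1 - 1 / (d : ℝ))) ^ 4 := by
  have hd' : (2 : ℝ) ≤ d := by exact_mod_cast hd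
  refine le_of_tendsto' (tendsto_prod_gam hd) fun n => ?_
  have ht : 0 < 1 - 1 / (d : ℝ) := by
    rw [sub_pos, div_lt_one (by linarith)]; linarith
  have hle : ∏ k ∈ range n, (1 + (1 / (d : ℝ)) ^ (2 ^ k)) ≤ 1 / (1 - 1 / (d : ℝ)) := by
    rw [le_div_iff₀' ht, prod_one_add_pow_two_pow]
    exact sub_le_self _ (by positivity)
  calc ∏ k ∈ range n, (1 + 2 / (d : ℝ) ^ (2 ^ k)) ^ 2
      ≤ ∏ k ∈ range n, (1 + (1 / (d : ℝ)) ^ (2 ^ k)) ^ 4 := by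
        refine prod_le_prod (fun k _ => by positivity) fun k _ => ?_
        have : 1 + 2 / (d : ℝ) ^ (2 ^ k) ≤ (1 + (1 / (d : ℝ)) ^ (2 ^ k)) ^ 2 := by
          rw [one_div_pow, div_eq_mul_one_div]
          nlinarith [sq_nonneg (1 / (d : ℝ) ^ (2 ^ k))]
        calc _ ≤ ((1 + (1 / (d : ℝ)) ^ (2 ^ k)) ^ 2) ^ 2 := by gcongr
          _ = _ := by ring
    _ = (∏ k ∈ range n, (1 + (1 / (d : ℝ)) ^ (2 ^ k))) ^ 4 := prod_pow _ _ _
    _ ≤ _ := by gcongr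

theorem gam_one : gam 1 = 25 := by simp [gam]

theorem gam_four_le : gam 4 ≤ 2.92 := by
  have h := gam_eq_mul_gam_sq (d := 4) (by norm_num)
  have h16 := gam_le (d := 16) (by norm_num)
  norm_num at h h16 ⊢
  linarith

theorem sq_mul_gam {d : ℕ} (hd : 2 ≤ d) :
    (d : ℝ) ^ 2 * gam d = ((d : ℝ) + 2) ^ 2 * gam (d ^ 2) := by
  have : (d : ℝ) ≠ 0 := by exact_mod_cast (by lia : d ≠ 0)
  rw [gam_eq_mul_gam_sq hd]
  field_simp

theorem mul_gam_le {d : ℕ} (hd : 2 ≤ d) : (d : ℝ) * gam d ≤ (d + 6) * gam (d ^ 2) := by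
  have hd' : (2 : ℝ) ≤ d := by exact_mod_cast hd
  have hg := one_le_gam (hd.trans (Nat.le_self_pow two_ne_zero d))
  have h := sq_mul_gam hd
  refine le_of_mul_le_mul_left ?_ (by linarith : (0 : ℝ) < d)
  rw [← mul_assoc, ← sq, h, ← mul_assoc]
  gcongr
  nlinarith

theorem mul_gam_le_twenty_five {d : ℕ} (h₁ : 1 ≤ d) (h₉ : d ≤ 9) : (d : ℝ) * gam d ≤ 25 := by
  have h4 := gam_four_le
  obtain rfl | rfl | rfl | rfl | h :
      d = 1 ∨ d = 2 ∨ d = 3 ∨ d = 9 ∨ (4 ≤ d ∧ d ≤ 8) := by lia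
  · simp [gam_one]
  · have h := mul_gam_le (d := 2) le_rfl
    norm_num at h h4 ⊢
    linarith
  · have h := gam_le (d := 3) (by norm_num)
    norm_num at h ⊢
    linarith
  · have h := gam_le (d := 9) (by norm_num)
    norm_num at h ⊢
    linarith
  · have hg := gam_anti (by norm_num) h.1
    have hd : (d : ℝ) ≤ 8 := by exact_mod_cast h.2
    have := one_le_gam (d := d) (by lia)
    nlinarith

/-- If `δ₁ ≤ (δ₂ + 2)²` then `δ₁·γ(δ₁) ≤ δ₂²·γ(δ₂)`. -/
theorem stmt_12 (d₁ d₂ : ℕ) (h₁ : 1 ≤ d₁) (h₂ : 1 ≤ d₂)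
    (h : d₁ ≤ (d₂ + 2) ^ 2) :
    (d₁ : ℝ) * gam d₁ ≤ (d₂ : ℝ) ^ 2 * gam d₂ := by
  obtain rfl | h₂ := h₂.eq_or_lt
  · simpa [gam_one] using mul_gam_le_twenty_five h₁ h
  replace h₂ : 2 ≤ d₂ := h₂
  have hd₂ : (2 : ℝ) ≤ d₂ := by exact_mod_cast h₂
  have hsq : 2 ≤ d₂ ^ 2 := h₂.trans (Nat.le_self_pow two_ne_zero d₂)
  have hg := one_le_gam hsq
  rw [sq_mul_gam h₂]
  obtain hle | hlt := le_or_gt (d₂ ^ 2) d₁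
  · have hd : (d₁ : ℝ) ≤ ((d₂ : ℝ) + 2) ^ 2 := by exact_mod_cast h
    have := one_le_gam (hsq.trans hle)
    have := gam_anti hsq hle
    gcongr
  have hd : (d₁ : ℝ) < (d₂ : ℝ) ^ 2 := by exact_mod_cast hlt
  obtain hle | hlt := le_or_gt d₂ d₁
  · refine (mul_gam_le (h₂.trans hle)).trans ?_
    have := gam_anti hsq (Nat.pow_le_pow_left hle 2)
    calc _ ≤ ((d₁ : ℝ) + 6) * gam (d₂ ^ 2) := by gcongr
      _ ≤ _ := by gcongr; nlinarith
  obtain h₃ | rfl : 3 ≤ d₂ ∨ d₂ = 2 := by lia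
  · have hd₃ : (3 : ℝ) ≤ d₂ := by exact_mod_cast h₃
    obtain rfl | h₁ := h₁.eq_or_lt
    · rw [gam_one]
      push_cast
      nlinarith
    · have h₁ : 2 ≤ d₁ := h₁
      have hlt' : (d₁ : ℝ) + 1 ≤ d₂ := by exact_mod_cast hlt
      have h4 := (gam_anti (by norm_num) (Nat.pow_le_pow_left h₁ 2)).trans gam_four_le
      calc (d₁ : ℝ) * gam d₁ ≤ (d₁ + 6) * gam (d₁ ^ 2) := mul_gam_le h₁
        _ ≤ (d₁ + 6) * 3 := by gcongr; linarith
        _ ≤ ((d₂ : ℝ) + 2) ^ 2 * 1 := by nlinarith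
        _ ≤ _ := by gcongr
  · obtain rfl : d₁ = 1 := by lia
    have h4 := gam_eq_mul_gam_sq (d := 4) (by norm_num)
    have h16 := one_le_gam (d := 16) (by norm_num)
    rw [gam_one]
    norm_num at h4 h16 ⊢
    linarith
end

section
/- For every real number δ ≥ 3, the series ∑_{k=0}^∞ 2^k/(δ^(2^k) + 2) converges and its sum is strictly less than 1/2. -/
theorem sum_range_two_pow_div_pow_add_one {x : ℝ} (hx : 1 < x) (n : ℕ) :
    ∑ k ∈ Finset.range n, (2 : ℝ) ^ k / (x ^ (2 ^ k) + 1) =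
      1 / (x - 1) - 2 ^ n / (x ^ (2 ^ n) - 1) := by
  induction n with
  | zero => simp
  | succ n ih =>
    have h : 1 < x ^ (2 ^ n) := one_lt_pow₀ hx (by positivity)
    rw [Finset.sum_range_succ, ih, pow_succ (2 : ℕ) n, pow_mul, pow_succ (2 : ℝ) n]
    generalize x ^ (2 ^ n) = y at h ⊢
    have h₁ : y - 1 ≠ 0 := by linarith
    have h₂ : y + 1 ≠ 0 := by linarith
    have h₃ : y ^ 2 - 1 = (y - 1) * (y + 1) := by ring
    have h₄ : x - 1 ≠ 0 := by linarith
    rw [h₃]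
    field_simp
    ring

/-- For `δ ≥ 3`, the series `∑ₖ 2^k/(δ^(2^k) + 2)` converges with sum `< 1/2`. -/
theorem stmt_13 (δ : ℝ) (hδ : 3 ≤ δ) :
    Summable (fun k : ℕ => (2 : ℝ) ^ k / (δ ^ (2 ^ k) + 2)) ∧
    ∑' k : ℕ, (2 : ℝ) ^ k / (δ ^ (2 ^ k) + 2) < 1 / 2 := by
  have hpos : 0 < δ := by linarith
  have hlt (k : ℕ) : (2 : ℝ) ^ k / (δ ^ (2 ^ k) + 2) < 2 ^ k / (δ ^ (2 ^ k) + 1) := by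
    gcongr
    norm_num
  have hnonneg (k : ℕ) : 0 ≤ (2 : ℝ) ^ k / (δ ^ (2 ^ k) + 1) := by positivity
  have hbound (n : ℕ) :
      ∑ k ∈ Finset.range n, (2 : ℝ) ^ k / (δ ^ (2 ^ k) + 1) ≤ 1 / 2 := by
    rw [sum_range_two_pow_div_pow_add_one (by linarith)]
    have h₁ : 1 ≤ δ ^ (2 ^ n) := one_le_pow₀ (by linarith)
    have h₂ : 0 ≤ 2 ^ n / (δ ^ (2 ^ n) - 1) := div_nonneg (by positivity) (by linarith)
    have h₃ : 1 / (δ - 1) ≤ 1 / 2 := one_div_le_one_div_of_le (by norm_num) (by linarith)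
    linarith
  have hsum := summable_of_sum_range_le hnonneg hbound
  have hsum' := Summable.of_nonneg_of_le (fun k => by positivity) (fun k => (hlt k).le) hsum
  exact ⟨hsum', (hsum'.tsum_lt_tsum (fun k => (hlt k).le) (hlt 0) hsum).trans_le
    (Real.tsum_le_of_sum_range_le hnonneg hbound)⟩
end

section
/- Let δ : ℕ → ℕ be a sequence such that δ_n ≥ 2 for all n ≥ N₀ (for some N₀) and the series ∑_n 1/δ_n diverges. Fix a real number ν > 1/2 and let S := {n : n ≥ max(N₀ + 2, 2) and δ_n ≤ ν·δ_(n−1)·δ_(n−2)}. Then the series ∑_{n ∈ S} 1/δ_n diverges. -/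
/-- A nonnegative sequence that contracts by a factor `θ < 1` up to a summable error is summable. -/
theorem summable_of_le_mul_add {f g : ℕ → ℝ} {θ : ℝ} (hf : ∀ k, 0 ≤ f k) (hg : ∀ k, 0 ≤ g k)
    (hθ₀ : 0 ≤ θ) (hθ : θ < 1) (h : ∀ k, f (k + 1) ≤ θ * f k + g k) (hsum : Summable g) :
    Summable f := by
  have hB : 0 ≤ ∑' k, g k := tsum_nonneg hg
  have hθ' : 0 < 1 - θ := by linarith
  have hf₀ := hf 0
  refine summable_of_sum_range_le (c := (f 0 + ∑' k, g k) / (1 - θ)) hf fun n => ?_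
  induction n with
  | zero => simpa using by positivity
  | succ n ih =>
    have hstep : ∑ k ∈ Finset.range n, f (k + 1) ≤
        θ * ∑ k ∈ Finset.range n, f k + ∑ k ∈ Finset.range n, g k := by
      rw [Finset.mul_sum, ← Finset.sum_add_distrib]
      exact Finset.sum_le_sum fun k _ => h k
    have hgn := hsum.sum_le_tsum (Finset.range n) fun k _ => hg k
    have hmul := mul_le_mul_of_nonneg_left ih hθ₀
    have hfix : θ * ((f 0 + ∑' k, g k) / (1 - θ)) + (f 0 + ∑' k, g k) =
        (f 0 + ∑' k, g k) / (1 - θ) := by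
      field_simp
      ring
    rw [Finset.sum_range_succ']
    linarith


/-- If `δₙ ≥ 2` eventually and `∑ 1/δₙ` diverges, then for `ν > 1/2`
the sub-series over `S = {n ≥ max(N₀+2,2) : δₙ ≤ ν·δ₍ₙ₋₁₎·δ₍ₙ₋₂₎}` diverges as well. -/
theorem stmt_14 (δ : ℕ → ℕ) (N₀ : ℕ) (hδ : ∀ n, N₀ ≤ n → 2 ≤ δ n)
    (hdiv : ¬ Summable (fun n : ℕ => (1 : ℝ) / δ n))
    (ν : ℝ) (hν : 1 / 2 < ν)
    (S : Set ℕ)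
    (hS : S = {n : ℕ | max (N₀ + 2) 2 ≤ n ∧
      (δ n : ℝ) ≤ ν * (δ (n - 1) : ℝ) * (δ (n - 2) : ℝ)}) :
    ¬ Summable (S.indicator fun n : ℕ => (1 : ℝ) / δ n) := by
  have hν₀ : 0 < ν := by linarith
  intro hsum
  refine hdiv ((summable_nat_add_iff (N₀ + 1)).1 ?_)
  refine summable_of_le_mul_add (θ := 1 / (2 * ν)) (fun k => by positivity)
    (fun k => Set.indicator_nonneg (fun n _ => by positivity) (k + (N₀ + 2))) (by positivity)
    (by rw [div_lt_one (by linarith)]; linarith) (fun k => ?_)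
    ((summable_nat_add_iff (N₀ + 2)).2 hsum)
  have hk : k + 1 + (N₀ + 1) = k + (N₀ + 2) := by ring
  rw [hk]
  by_cases hmem : k + (N₀ + 2) ∈ S
  · rw [Set.indicator_of_mem hmem]
    have : 0 ≤ 1 / (2 * ν) * (1 / (δ (k + (N₀ + 1)) : ℝ)) := by positivity
    linarith
  · rw [Set.indicator_of_notMem hmem, add_zero]
    simp only [hS, Set.mem_ofPred_eq, not_and, not_le] at hmem
    have hlt := hmem (by omega)
    have h₁ : k + (N₀ + 2) - 1 = k + (N₀ + 1) := by omega
    have h₂ : k + (N₀ + 2) - 2 = k + N₀ := by omega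
    rw [h₁, h₂] at hlt
    have hx : (2 : ℝ) ≤ δ (k + (N₀ + 1)) := by exact_mod_cast hδ _ (by omega)
    have hy : (2 : ℝ) ≤ δ (k + N₀) := by exact_mod_cast hδ _ (by omega)
    rw [one_div_mul_one_div]
    apply one_div_le_one_div_of_le (by positivity)
    have := mul_le_mul_of_nonneg_left hy
      (show 0 ≤ ν * (δ (k + (N₀ + 1)) : ℝ) by positivity)
    linarith
end

section
/- Let ν ≥ 1/2 be a real number, let δ : ℕ → ℕ be a sequence, and let n, N be indices with δ_(n−1) ≥ 2, δ_n ≥ 1, and δ_(n+i) > ν·δ_(n+i−1)·δ_(n+i−2) for all i ∈ {1, ..., N}. Then δ_(n+i) ≥ (1/ν)·(ν·δ_n)^(F_(i+1)) for all i ∈ {0, ..., N}, where F_i denotes the i-th Fibonacci number with F₁ = F₂ = 1. -/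
/-- Fibonacci lower bound `δ₍ₙ₊ᵢ₎ ≥ (1/ν)·(ν·δₙ)^(F₍ᵢ₊₁₎)`, where
`F` is the Fibonacci sequence with `F₁ = F₂ = 1` (i.e. `Nat.fib`). -/
theorem stmt_15 (ν : ℝ) (hν : 1 / 2 ≤ ν) (δ : ℕ → ℕ) (n N : ℕ)
    (h1 : 2 ≤ δ (n - 1)) (h2 : 1 ≤ δ n)
    (h3 : ∀ i, 1 ≤ i → i ≤ N →
      ν * (δ (n + i - 1) : ℝ) * (δ (n + i - 2) : ℝ) < (δ (n + i) : ℝ)) :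
    ∀ i, i ≤ N →
      (1 / ν) * (ν * (δ n : ℝ)) ^ (Nat.fib (i + 1)) ≤ (δ (n + i) : ℝ) := by
  have hν0 : 0 < ν := by linarith
  have key : ∀ i, i ≤ N → (ν * (δ n : ℝ)) ^ (Nat.fib (i + 1)) ≤ ν * (δ (n + i) : ℝ) := by
    intro i
    induction i using Nat.twoStepInduction with
    | zero => simp
    | one =>
      intro hi
      have h := h3 1 le_rfl hi
      rw [show n + 1 - 1 = n by lia, show n + 1 - 2 = n - 1 by lia] at h
      have h1' : (2 : ℝ) ≤ δ (n - 1) := by exact_mod_cast h1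
      have hge : 1 ≤ ν * (δ (n - 1) : ℝ) := by nlinarith
      have hle : (δ n : ℝ) ≤ δ (n + 1) := by
        have := mul_le_mul_of_nonneg_left hge (Nat.cast_nonneg (α := ℝ) (δ n))
        linarith
      simpa using mul_le_mul_of_nonneg_left hle hν0.le
    | more k ih0 ih1 =>
      intro hk
      have h := h3 (k + 2) (by lia) hk
      rw [show n + (k + 2) - 1 = n + (k + 1) by lia, show n + (k + 2) - 2 = n + k by lia] at h
      calc (ν * (δ n : ℝ)) ^ Nat.fib (k + 2 + 1)
          = (ν * (δ n : ℝ)) ^ Nat.fib (k + 1) * (ν * (δ n : ℝ)) ^ Nat.fib (k + 1 + 1) := by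
            rw [← pow_add, Nat.fib_add_two (n := k + 1)]
        _ ≤ (ν * (δ (n + k) : ℝ)) * (ν * (δ (n + (k + 1)) : ℝ)) :=
            mul_le_mul (ih0 (by lia)) (ih1 (by lia)) (by positivity) (by positivity)
        _ = ν * (ν * (δ (n + (k + 1)) : ℝ) * (δ (n + k) : ℝ)) := by ring
        _ ≤ ν * (δ (n + (k + 2)) : ℝ) := mul_le_mul_of_nonneg_left h.le hν0.le
  intro i hi
  rw [one_div, inv_mul_le_iff₀ hν0]
  exact key i hi
end
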